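/- arXiv:1910.13871 — 2 statements merged into one kernel-verified Lean document; each statement's English description precedes it below -/
import Mathlib

section
/- Let λ ∈ (0,1). For all m₁, m₂ with 0 < m₁ ≤ m₂ and every integer a ≥ 1, the thresholds satisfy D_a(m₁) ≤ D_a(m₂). Consequently the idle sets Π_m = {(a,d) : a ≥ 1, 0 ≤ d < D_a(m)} satisfy Π_{m₁} ⊆ Π_{m₂}, i.e., the decoupled AoI scheduling problem is indexable. -/
/-- `φ_λ(J)` with `D = ⌈J − 1/λ⌉` (equation (13) of the paper). -/
noncomputable def phi (lam J : ℝ) : ℝ :=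
  ((⌈J - 1 / lam⌉ : ℝ) - 1 + 1 / lam) * J - (⌈J - 1 / lam⌉ : ℝ) ^ 2 / 2
    + (⌈J - 1 / lam⌉ : ℝ) / 2 - (⌈J - 1 / lam⌉ : ℝ) / lam + (lam - 1) / lam ^ 2

/-- `J_λ(m)`: the unique `J ≥ 1/λ` with `φ_λ(J) = m` (realized as an infimum,
which equals the unique solution). -/
noncomputable def Jlam (lam m : ℝ) : ℝ :=
  sInf {J : ℝ | 1 / lam ≤ J ∧ phi lam J = m}

/-- Thresholds `D_a(m)`: `⌈(1−λ+aλ)J_λ(m) − a + 1 − λa(a−1)/2 − 1/λ⌉` for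
`1 ≤ a < D₁` and `⌈λm⌉` for `a ≥ D₁`, where `D₁ = ⌈J_λ(m) − 1/λ⌉`. -/
noncomputable def Dthresh (lam m : ℝ) (a : ℕ) : ℤ :=
  if (a : ℤ) < ⌈Jlam lam m - 1 / lam⌉ then
    ⌈(1 - lam + (a : ℝ) * lam) * Jlam lam m - (a : ℝ) + 1
      - lam * ((a : ℝ) * ((a : ℝ) - 1) / 2) - 1 / lam⌉
  else ⌈lam * m⌉

/-- The idle set `Π_m = {(a,d) : a ≥ 1, 0 ≤ d < D_a(m)}`. -/
def idleSet (lam m : ℝ) : Set (ℕ × ℕ) :=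
  {p : ℕ × ℕ | 1 ≤ p.1 ∧ (p.2 : ℤ) < Dthresh lam m p.1}

/-- The affine pieces whose upper envelope is `phi`, in the shifted variable `x = J - 1 / lam`
and with `u = 1 / lam`. -/
noncomputable def phiLine (u : ℝ) (n : ℤ) (x : ℝ) : ℝ :=
  ((n : ℝ) - 1 + u) * x - (n : ℝ) * ((n : ℝ) - 1) / 2

theorem phi_eq_phiLine {lam : ℝ} (hlam : lam ≠ 0) (J : ℝ) :
    phi lam J = phiLine (1 / lam) ⌈J - 1 / lam⌉ (J - 1 / lam) := by
  unfold phi phiLine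
  field_simp
  ring

theorem phiLine_le_phiLine_ceil (u : ℝ) (n : ℤ) (x : ℝ) :
    phiLine u n x ≤ phiLine u ⌈x⌉ x := by
  have h1 := Int.le_ceil x
  have h2 := Int.ceil_lt_add_one x
  unfold phiLine
  generalize ⌈x⌉ = D at *
  rcases lt_trichotomy n D with h | h | h
  · have h3 : (n : ℝ) + 1 ≤ D := by exact_mod_cast h
    nlinarith
  · rw [h]
  · have h3 : (D : ℝ) + 1 ≤ n := by exact_mod_cast h
    nlinarith

theorem phiLine_le_phiLine {u : ℝ} (hu : 1 < u) {n : ℤ} (hn : 0 ≤ n) {x y : ℝ} (h : x ≤ y) :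
    phiLine u n x ≤ phiLine u n y := by
  have h0 : (0 : ℝ) ≤ n := by exact_mod_cast hn
  have h1 := mul_le_mul_of_nonneg_left h (by linarith : (0 : ℝ) ≤ (n : ℝ) - 1 + u)
  unfold phiLine
  linarith

theorem phiLine_lt_phiLine {u : ℝ} (hu : 1 < u) {n : ℤ} (hn : 0 ≤ n) {x y : ℝ} (h : x < y) :
    phiLine u n x < phiLine u n y := by
  have h0 : (0 : ℝ) ≤ n := by exact_mod_cast hn
  have h1 := mul_lt_mul_of_pos_left h (by linarith : (0 : ℝ) < (n : ℝ) - 1 + u)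
  unfold phiLine
  linarith

theorem strictMonoOn_phiLine_ceil {u : ℝ} (hu : 1 < u) :
    StrictMonoOn (fun x : ℝ => phiLine u ⌈x⌉ x) (Set.Ici 0) := fun _ hx y _ h =>
  (phiLine_lt_phiLine hu (Int.ceil_nonneg hx) h).trans_le (phiLine_le_phiLine_ceil u _ y)

theorem exists_phiLine_ceil_eq {u : ℝ} (hu : 1 < u) {m : ℝ} (hm : 0 < m) :
    ∃ x : ℝ, 0 ≤ x ∧ phiLine u ⌈x⌉ x = m := by
  classical
  have hex : ∃ n : ℕ, m ≤ phiLine u n n := by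
    obtain ⟨n, hn⟩ := exists_nat_ge m
    refine ⟨n, hn.trans ?_⟩
    have h := phiLine_le_phiLine_ceil u 1 (n : ℝ)
    rw [Int.ceil_natCast] at h
    refine le_trans ?_ h
    have h0 : (0 : ℝ) ≤ n := n.cast_nonneg
    simp only [phiLine, Int.cast_one]
    nlinarith
  have hspec := Nat.find_spec hex
  have hmin := fun k => Nat.find_min (m := k) hex
  generalize Nat.find hex = n at hspec hmin
  obtain _ | k := n
  · simp [phiLine] at hspec
    linarith
  · have hk := hmin k k.lt_succ_self
    have h0 : (0 : ℝ) ≤ k := k.cast_nonneg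
    have hpos : 0 < (k : ℝ) + u := by linarith
    simp only [phiLine, not_le] at hk hspec
    push_cast at hk hspec
    set x : ℝ := (m + ((k : ℝ) + 1) * k / 2) / ((k : ℝ) + u) with hx
    have hlo : (k : ℝ) < x := by
      rw [hx, lt_div_iff₀ hpos]
      linarith
    have hhi : x ≤ (k : ℝ) + 1 := by
      rw [hx, div_le_iff₀ hpos]
      linarith
    have hceil : ⌈x⌉ = (k : ℤ) + 1 := by
      rw [Int.ceil_eq_iff]
      push_cast
      exact ⟨by linarith, hhi⟩
    refine ⟨x, by linarith, ?_⟩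
    have hmul : x * ((k : ℝ) + u) = m + ((k : ℝ) + 1) * k / 2 := div_mul_cancel₀ _ hpos.ne'
    rw [hceil, phiLine]
    push_cast
    linarith

theorem Jlam_spec {lam m : ℝ} (hlam : lam ∈ Set.Ioo (0 : ℝ) 1) (hm : 0 < m) :
    0 ≤ Jlam lam m - 1 / lam ∧
      phiLine (1 / lam) ⌈Jlam lam m - 1 / lam⌉ (Jlam lam m - 1 / lam) = m := by
  have hu : 1 < 1 / lam := one_lt_one_div hlam.1 hlam.2
  obtain ⟨x, hx0, hx⟩ := exists_phiLine_ceil_eq hu hm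
  have hset : {J : ℝ | 1 / lam ≤ J ∧ phi lam J = m} = {x + 1 / lam} := by
    ext J
    simp only [Set.mem_ofPred_eq, Set.mem_singleton_iff, phi_eq_phiLine hlam.1.ne']
    constructor
    · rintro ⟨h1, h2⟩
      exact sub_eq_iff_eq_add.mp ((strictMonoOn_phiLine_ceil hu).injOn
        (Set.mem_Ici.mpr (sub_nonneg.mpr h1)) hx0 (h2.trans hx.symm))
    · rintro rfl
      rw [add_sub_cancel_right]
      exact ⟨by linarith, hx⟩
  rw [Jlam, hset, csInf_singleton, add_sub_cancel_right]
  exact ⟨hx0, hx⟩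

theorem Dthresh_eq {lam : ℝ} (hlam : lam ≠ 0) (m : ℝ) (a : ℕ) :
    Dthresh lam m a = if (a : ℤ) < ⌈Jlam lam m - 1 / lam⌉ then
      ⌈lam * phiLine (1 / lam) a (Jlam lam m - 1 / lam)⌉ else ⌈lam * m⌉ := by
  unfold Dthresh phiLine
  congr 2
  push_cast
  field_simp
  ring

theorem Dthresh_mono {lam : ℝ} (hlam : lam ∈ Set.Ioo (0 : ℝ) 1) {m₁ m₂ : ℝ} (hm₁ : 0 < m₁)
    (hm : m₁ ≤ m₂) (a : ℕ) : Dthresh lam m₁ a ≤ Dthresh lam m₂ a := by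
  have hu : 1 < 1 / lam := one_lt_one_div hlam.1 hlam.2
  obtain ⟨h1, e1⟩ := Jlam_spec hlam hm₁
  obtain ⟨h2, e2⟩ := Jlam_spec hlam (hm₁.trans_le hm)
  rw [Dthresh_eq hlam.1.ne', Dthresh_eq hlam.1.ne']
  generalize Jlam lam m₁ - 1 / lam = x at *
  generalize Jlam lam m₂ - 1 / lam = y at *
  have hxy : x ≤ y := by
    refine ((strictMonoOn_phiLine_ceil hu).le_iff_le h1 h2).mp ?_
    simpa only [e1, e2] using hm
  have hceil : ⌈x⌉ ≤ ⌈y⌉ := Int.ceil_le_ceil hxy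
  split_ifs with hx hy hy
  · exact Int.ceil_le_ceil (mul_le_mul_of_nonneg_left
      (phiLine_le_phiLine hu (Int.natCast_nonneg a) hxy) hlam.1.le)
  · omega
  · refine Int.ceil_le_ceil (mul_le_mul_of_nonneg_left ?_ hlam.1.le)
    have hxa : x ≤ a := by simpa using Int.ceil_le.mp (not_lt.mp hx)
    have hay : (a : ℝ) ≤ y := by simpa using (Int.lt_ceil.mp hy).le
    calc m₁ = phiLine (1 / lam) ⌈x⌉ x := e1.symm
      _ ≤ phiLine (1 / lam) ⌈(a : ℝ)⌉ a :=
        (strictMonoOn_phiLine_ceil hu).monotoneOn h1 (Set.mem_Ici.mpr a.cast_nonneg) hxa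
      _ = phiLine (1 / lam) a a := by rw [Int.ceil_natCast]
      _ ≤ phiLine (1 / lam) a y := phiLine_le_phiLine hu (Int.natCast_nonneg a) hay
  · exact Int.ceil_le_ceil (mul_le_mul_of_nonneg_left hm hlam.1.le)

/-- Indexability (Theorem 2 of the paper): thresholds are monotone in the
service charge `m`, hence the idle sets are nested. -/
theorem stmt_7 (lam : ℝ) (hlam : lam ∈ Set.Ioo (0 : ℝ) 1)
    (m₁ m₂ : ℝ) (hm₁ : 0 < m₁) (hm : m₁ ≤ m₂) :
    (∀ a : ℕ, 1 ≤ a → Dthresh lam m₁ a ≤ Dthresh lam m₂ a) ∧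
    idleSet lam m₁ ⊆ idleSet lam m₂ :=
  ⟨fun a _ => Dthresh_mono hlam hm₁ hm a,
    fun p hp => ⟨hp.1, hp.2.trans_le (Dthresh_mono hlam hm₁ hm p.1)⟩⟩
end

section
/- Let λ ∈ (0,1). For every integer a ≥ 1 and every integer d ≥ 0 there exists m₀ > 0 such that d < D_a(m) for all m ≥ m₀; equivalently, for each a ≥ 1 the threshold D_a(m) tends to infinity as m → ∞, so that every state eventually lies in the idle set Π_m. -/
theorem phi_le_sq_add_one {lam J : ℝ} (h₀ : 0 < lam) (h₁ : lam < 1) (hJ : 1 / lam ≤ J) :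
    phi lam J ≤ J ^ 2 + 1 := by
  have hx : 1 < 1 / lam := by rw [lt_div_iff₀ h₀]; linarith
  have hD : (0 : ℝ) ≤ (⌈J - 1 / lam⌉ : ℝ) := by
    exact_mod_cast Int.ceil_nonneg (sub_nonneg.2 hJ)
  have hD' := Int.ceil_lt_add_one (J - 1 / lam)
  have hlast : (lam - 1) / lam ^ 2 ≤ 0 :=
    div_nonpos_of_nonpos_of_nonneg (by linarith) (sq_nonneg lam)
  have hmid : 0 ≤ (⌈J - 1 / lam⌉ : ℝ) / lam := div_nonneg hD h₀.le
  unfold phi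
  generalize (⌈J - 1 / lam⌉ : ℝ) = D at *
  nlinarith [mul_nonneg (show 0 ≤ J by linarith) (show 0 ≤ J - (D - 1 + 1 / lam) by linarith),
    sq_nonneg (D - 1)]

/-- Positivity of `⌈J_λ(m) − 1/λ⌉` forces the defining set of `J_λ(m)` to be nonempty,
so `J_λ(m)` is large when `m` is. -/
theorem le_Jlam {lam m K : ℝ} (h₀ : 0 < lam) (h₁ : lam < 1) (hm : K ^ 2 + 1 < m)
    (hJ : 0 < ⌈Jlam lam m - 1 / lam⌉) : K ≤ Jlam lam m := by
  have hx : 0 < 1 / lam := one_div_pos.2 h₀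
  refine le_csInf ?_ ?_
  · rw [Set.nonempty_iff_ne_empty]
    intro he
    rw [Int.ceil_pos, Jlam, he, Real.sInf_empty] at hJ
    linarith
  · rintro J ⟨hJ₁, hJ₂⟩
    have := phi_le_sq_add_one h₀ h₁ hJ₁
    exact le_of_lt (lt_of_pow_lt_pow_left₀ 2 (by linarith) (by linarith))

/-- Second part of the indexability condition (Theorem 2 of the paper):
every state eventually lies in the idle set as `m → ∞`. -/
theorem stmt_8 (lam : ℝ) (hlam : lam ∈ Set.Ioo (0 : ℝ) 1) :
    ∀ a d : ℕ, 1 ≤ a →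
      ∃ m₀ : ℝ, 0 < m₀ ∧ ∀ m : ℝ, m₀ ≤ m → (d : ℤ) < Dthresh lam m a := by
  obtain ⟨h₀, h₁⟩ := hlam
  intro a d ha
  have ha' : (1 : ℝ) ≤ a := by exact_mod_cast ha
  have hx : 0 < 1 / lam := one_div_pos.2 h₀
  have hd : (0 : ℝ) ≤ d := d.cast_nonneg
  have hq : 0 ≤ lam * ((a : ℝ) * ((a : ℝ) - 1) / 2) :=
    mul_nonneg h₀.le (div_nonneg (mul_nonneg (by linarith) (by linarith)) zero_le_two)
  set K : ℝ := d + a + lam * ((a : ℝ) * ((a : ℝ) - 1) / 2) + 1 / lam with hK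
  have hdl : 0 ≤ ((d : ℝ) + 1) / lam := by positivity
  refine ⟨K ^ 2 + 2 + (d + 1) / lam, by positivity, fun m hm => ?_⟩
  unfold Dthresh
  split_ifs with h
  · have hKJ : K ≤ Jlam lam m := le_Jlam h₀ h₁ (by linarith) (by omega)
    rw [Int.lt_ceil]
    push_cast
    have : 0 ≤ ((a : ℝ) - 1) * lam * Jlam lam m :=
      mul_nonneg (mul_nonneg (by linarith) h₀.le) (by linarith)
    linarith
  · rw [Int.lt_ceil]
    push_cast
    have : ((d : ℝ) + 1) / lam ≤ m := by nlinarith [sq_nonneg K]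
    rw [div_le_iff₀ h₀] at this
    linarith
end
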